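/- arXiv:2105.06308 — 5 statements merged into one kernel-verified Lean document; each statement's English description precedes it below -/
import Mathlib

section
/- There exists a grading function for G = ℤ, i.e. a map gr : Curves_ℤ × Curves_ℤ → ℤ satisfying the symmetry, transitivity and linearity identities. -/
open OnePoint

/-- The space of slopes `QP¹ = ℚ ∪ {∞}`. -/
abbrev QP1 : Type := OnePoint ℚ

/-- `Incr3 x y z` means `(x,y,z)` is an increasing triple of pairwise distinct slopes
in the counter-clockwise cyclic order on `QP¹`. -/
def Incr3 : QP1 → QP1 → QP1 → Prop
  | Option.some a, Option.some b, Option.some c =>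
      (a < b ∧ b < c) ∨ (b < c ∧ c < a) ∨ (c < a ∧ a < b)
  | Option.some a, Option.some b, Option.none => a < b
  | Option.some a, Option.none, Option.some c => c < a
  | Option.none, Option.some b, Option.some c => b < c
  | _, _, _ => False

/-- A line: a slope together with a grading in `G` and a bit `ε`, which is `false`
for rational lines and `true` for special ones. -/
structure Line (G : Type*) where
  slope : QP1
  grade : G
  eps : Bool

/-- The `G`-action on lines: `n · (s, g, ε) = (s, g + n, ε)`. -/
def Line.shift {G : Type*} [Add G] (c : Line G) (n : G) : Line G :=
  ⟨c.slope, c.grade + n, c.eps⟩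

/-- The axioms (symmetry, transitivity, linearity) for a grading function. -/
structure IsGradingFunction {G : Type*} [CommRing G] (gr : Line G → Line G → G) : Prop where
  symm_eq : ∀ c c' : Line G, c.slope = c'.slope → gr c c' + gr c' c = 0
  symm_ne : ∀ c c' : Line G, c.slope ≠ c'.slope → gr c c' + gr c' c = -1
  trans : ∀ c c' c'' : Line G, Incr3 c.slope c'.slope c''.slope →
      gr c c' + gr c' c'' = gr c c''
  linear : ∀ (n n' : G) (c c' : Line G),
      gr (c.shift n) (c'.shift n') = gr c c' + n' - n

/-- `G ∈ {ℤ, ℤ/2}`. -/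
def GoodG (G : Type*) [CommRing G] : Prop :=
  Nonempty (G ≃+* ℤ) ∨ Nonempty (G ≃+* ZMod 2)

/-- The set of supporting slopes of a set of lines. -/
def SlopesOf {G : Type*} (C : Set (Line G)) : Set QP1 := Line.slope '' C

/-- `C` is `s`-rational: every line in `C` of slope `s` is rational. -/
def SRational {G : Type*} (C : Set (Line G)) (s : QP1) : Prop :=
  ∀ c ∈ C, c.slope = s → c.eps = false

/-- `C` is `s`-special: every line in `C` of slope `s` is special. -/
def SSpecial {G : Type*} (C : Set (Line G)) (s : QP1) : Prop :=
  ∀ c ∈ C, c.slope = s → c.eps = true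

/-- `C` is `s`-consistent with respect to the grading function `gr`. -/
def Consistent {G : Type*} [CommRing G] (gr : Line G → Line G → G) (C : Set (Line G)) (s : QP1) :
    Prop :=
  ∀ c ∈ C, ∀ c' ∈ C, c.slope = s → c'.slope = s → gr c c' = 0

/-- A trivial line set: all lines special and concentrated in a single slope. -/
def TrivialLineSet {G : Type*} (C : Set (Line G)) : Prop :=
  ∃ s : QP1, SlopesOf C = {s} ∧ SSpecial C s

/-- The pair `(C, D)` is thin with respect to `gr`. -/
def ThinPair {G : Type*} [CommRing G] (gr : Line G → Line G → G) (C D : Set (Line G)) : Prop :=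
  ∃ n : G, ∀ c ∈ C, ∀ d ∈ D,
    (c.slope = d.slope → c.eps ≠ d.eps) ∧ (c.slope ≠ d.slope → gr c d = n)

/-- The thin filling space `Θ(C)` of a set of lines. -/
def Theta {G : Type*} [CommRing G] (gr : Line G → Line G → G) (C : Set (Line G)) :
    Set QP1 :=
  {s | ThinPair gr {⟨s, 0, false⟩} C}

open scoped Classical in
/-- The open interval `(a, b)` in `QP¹`, with the convention `(a, a) = QP¹ ∖ {a}`. -/
noncomputable def Intvl (a b : QP1) : Set QP1 :=
  if a = b then {a}ᶜ else {s | Incr3 a s b}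

/-- An interval in `QP¹`: one of `(a,b)`, `[a,b)`, `(a,b]`, `[a,b]`, containing
at least two points. -/
def IsInterval (X : Set QP1) : Prop :=
  X.Nontrivial ∧ ∃ a b : QP1,
    X = Intvl a b ∨ X = insert a (Intvl a b) ∨ X = insert b (Intvl a b) ∨
      X = insert a (insert b (Intvl a b))

/-- Exceptional line sets. -/
def Exceptional {G : Type*} [CommRing G] (gr : Line G → Line G → G) (C : Set (Line G)) : Prop :=
  ∃ s s' : QP1, s ≠ s' ∧ SlopesOf C = {s, s'} ∧
    Consistent gr C s ∧ Consistent gr C s' ∧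
    ∃ c ∈ C, ∃ c' ∈ C, c.slope = s ∧ c'.slope = s' ∧ gr c c' ≠ 0 ∧ gr c' c ≠ 0

/-- Reduction of lines modulo 2: `(s, g, ε) ↦ (s, g mod 2, ε)`. -/
def redLine (c : Line ℤ) : Line (ZMod 2) := ⟨c.slope, (c.grade : ZMod 2), c.eps⟩

/-- Twist: `0` if `x ≤ y` in the linear order with `∞` on top, and `-1` otherwise. -/
def slopeTwist : QP1 → QP1 → ℤ
  | Option.some a, Option.some b => if a ≤ b then 0 else -1
  | Option.some _, Option.none => 0
  | Option.none, Option.some _ => -1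
  | Option.none, Option.none => 0

theorem slopeTwist_self (x : QP1) : slopeTwist x x = 0 := by
  rcases x with _ | a <;> simp [slopeTwist]

theorem slopeTwist_ne (x y : QP1) (h : x ≠ y) : slopeTwist x y + slopeTwist y x = -1 := by
  rcases x with _ | a <;> rcases y with _ | b
  · exact absurd rfl h
  · simp [slopeTwist]
  · simp [slopeTwist]
  · have hab : a ≠ b := fun e => h (by rw [e])
    simp only [slopeTwist]
    grind

theorem slopeTwist_trans (x y z : QP1) (h : Incr3 x y z) :
    slopeTwist x y + slopeTwist y z = slopeTwist x z := by
  rcases x with _ | a <;> rcases y with _ | b <;> rcases z with _ | c <;>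
    simp only [slopeTwist, Incr3] at h ⊢ <;> grind

/-- There exists a grading function for `G = ℤ`. -/
theorem statement0 : ∃ gr : Line ℤ → Line ℤ → ℤ, IsGradingFunction gr := by
  refine ⟨fun c c' => c'.grade - c.grade + slopeTwist c.slope c'.slope, ?_, ?_, ?_, ?_⟩
  · intro c c' h
    simp only [h, slopeTwist_self]
    ring
  · intro c c' h
    have := slopeTwist_ne _ _ h
    linarith
  · intro c c' c'' h
    have := slopeTwist_trans _ _ _ h
    linarith
  · intro n n' c c'
    simp only [Line.shift]
    ring
end

section
/- Let C be a line set with |Slopes_C| > 2 and Θ(C) ⊆ Slopes_C. Then Θ(C) contains at most one slope. -/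
open OnePoint

theorem Incr3.rot {a b c : QP1} (h : Incr3 a b c) : Incr3 b c a := by
  rcases a with _ | a <;> rcases b with _ | b <;> rcases c with _ | c <;>
    simp only [Incr3] at h ⊢ <;> first | exact h | tauto

theorem incr3_total {a b c : QP1} (hab : a ≠ b) (hbc : b ≠ c) (hac : a ≠ c) :
    Incr3 a b c ∨ Incr3 b a c := by
  rcases a with _ | a <;> rcases b with _ | b <;> rcases c with _ | c <;>
    simp only [Incr3, ne_eq, not_true_eq_false, Option.some.injEq] at hab hbc hac ⊢
  all_goals first
    | exact absurd rfl hab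
    | exact absurd rfl hbc
    | exact absurd rfl hac
    | skip
  · have : b ≠ c := fun h => hbc (congrArg _ h)
    grind
  · have : a ≠ c := fun h => hac (congrArg _ h)
    grind
  · have : a ≠ b := fun h => hab (congrArg _ h)
    grind
  · have h1 : a ≠ b := fun h => hab (congrArg _ h)
    have h2 : b ≠ c := fun h => hbc (congrArg _ h)
    have h3 : a ≠ c := fun h => hac (congrArg _ h)
    grind

theorem incr3_ne {a b c : QP1} (h : Incr3 a b c) : a ≠ b ∧ b ≠ c ∧ a ≠ c := by
  refine ⟨?_, ?_, ?_⟩ <;> rintro rfl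
  · rcases a with _ | a <;> rcases c with _ | c <;> simp only [Incr3] at h <;> grind
  · rcases a with _ | a <;> rcases b with _ | b <;> simp only [Incr3] at h <;> grind
  · rcases a with _ | a <;> rcases b with _ | b <;> simp only [Incr3] at h <;> grind

theorem incr3_dense {a b : QP1} (h : a ≠ b) : ∃ t, Incr3 a t b := by
  rcases a with _ | a <;> rcases b with _ | b
  · exact absurd rfl h
  · exact ⟨Option.some (b - 1), by simp [Incr3]⟩
  · exact ⟨Option.some (a + 1), by simp [Incr3]⟩
  · have h1 : a ≠ b := fun h' => h (congrArg _ h')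
    rcases lt_or_gt_of_ne h1 with h2 | h2
    · exact ⟨Option.some ((a + b) / 2), by simp only [Incr3]; left; constructor <;> linarith⟩
    · exact ⟨Option.none, by simpa only [Incr3] using h2⟩

theorem incr3_trans {s s' c t : QP1} (h1 : Incr3 s c s') (h2 : Incr3 s' t s) :
    Incr3 s' t c := by
  rcases s with _ | s <;> rcases s' with _ | s' <;> rcases c with _ | c <;>
    rcases t with _ | t <;> simp only [Incr3] at h1 h2 ⊢ <;> grind

theorem theta_core {G : Type*} [CommRing G] (h01 : (1 : G) ≠ 0)
    (gr : Line G → Line G → G) (hgr : IsGradingFunction gr)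
    (C : Set (Line G)) (hsub : Theta gr C ⊆ SlopesOf C) (s s' : QP1)
    (hs : s ∈ Theta gr C) (hs' : s' ∈ Theta gr C) (c : Line G) (hc : c ∈ C)
    (hi : Incr3 s c.slope s') : False := by
  obtain ⟨n, hn⟩ := hs
  obtain ⟨n', hn'⟩ := hs'
  obtain ⟨h1, h2, h3⟩ := incr3_ne hi
  have hn2 : ∀ d ∈ C, s ≠ d.slope → gr ⟨s, 0, false⟩ d = n :=
    fun d hd h => (hn _ rfl d hd).2 h
  have hn2' : ∀ d ∈ C, s' ≠ d.slope → gr ⟨s', 0, false⟩ d = n' :=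
    fun d hd h => (hn' _ rfl d hd).2 h
  have e1 := hgr.trans ⟨s, 0, false⟩ c ⟨s', 0, false⟩ hi
  have e2 := hgr.symm_ne ⟨s', 0, false⟩ c h2.symm
  have e3 := hgr.symm_ne ⟨s, 0, false⟩ ⟨s', 0, false⟩ h3
  have e4 := hn2 c hc h1
  have e5 := hn2' c hc h2.symm
  -- no line of `C` lies on the other side
  have key : ∀ d ∈ C, ¬ Incr3 s' d.slope s := by
    intro d hd hi2
    obtain ⟨k1, k2, -⟩ := incr3_ne hi2
    have f1 := hgr.trans ⟨s', 0, false⟩ d ⟨s, 0, false⟩ hi2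
    have f2 := hgr.symm_ne ⟨s, 0, false⟩ d k2.symm
    have f3 := hn2 d hd k2.symm
    have f4 := hn2' d hd k1
    apply h01
    linear_combination e2 + f2 - e1 - f1 - e3 + e4 - e5 + f4 - f3
  obtain ⟨t, ht⟩ := incr3_dense h3.symm
  obtain ⟨t1, t2, -⟩ := incr3_ne ht
  have htC : t ∈ Theta gr C := by
    refine ⟨n' - gr ⟨s', 0, false⟩ ⟨t, 0, false⟩, ?_⟩
    rintro _ rfl d hd
    refine ⟨fun h => absurd ?_ (key d hd), fun _ => ?_⟩
    · have h' : t = d.slope := h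
      rw [← h']; exact ht
    have g1 := hgr.trans ⟨s', 0, false⟩ ⟨t, 0, false⟩ ⟨s, 0, false⟩ ht
    by_cases hds' : s' = d.slope
    · have g2 := hgr.trans ⟨t, 0, false⟩ ⟨s, 0, false⟩ d (by
        have := ht.rot
        rw [hds'] at this
        exact this)
      have g3 := hn2 d hd (by rw [← hds']; exact h3)
      linear_combination g1 - g2 + g3 + e3 + e1 - e2 - e4 + e5
    · have g3 := hn2' d hd hds'
      have hinc : Incr3 s' t d.slope := by
        by_cases hds : s = d.slope
        · rw [← hds]; exact ht
        · rcases incr3_total hds (Ne.symm hds') h3 with h | h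
          · exact incr3_trans h ht
          · exact absurd h.rot.rot (key d hd)
      have g2 := hgr.trans ⟨s', 0, false⟩ ⟨t, 0, false⟩ d hinc
      linear_combination g2 + g3
  obtain ⟨d, hd, hdt⟩ := hsub htC
  exact key d hd (by rw [hdt]; exact ht)

/-- If `|Slopes_C| > 2` and `Θ(C) ⊆ Slopes_C`, then `Θ(C)` contains at
most one slope. -/
theorem statement6 (G : Type*) [CommRing G] (hG : GoodG G)
    (gr : Line G → Line G → G) (hgr : IsGradingFunction gr)
    (C : Set (Line G)) (hCfin : C.Finite) (hCne : C.Nonempty)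
    (hcard : 2 < (SlopesOf C).ncard) (hsub : Theta gr C ⊆ SlopesOf C) :
    (Theta gr C).Subsingleton := by
  have h01 : (1 : G) ≠ 0 := by
    rcases hG with ⟨⟨e⟩⟩ | ⟨⟨e⟩⟩
    · intro h; have := congrArg e h; simp at this
    · intro h; have := congrArg e h; simp at this
  intro s hs s' hs'
  by_contra hne
  obtain ⟨x, ⟨c, hc, rfl⟩, hx⟩ : ∃ x ∈ SlopesOf C, x ∉ ({s, s'} : Set QP1) := by
    by_contra hcon
    push Not at hcon
    have h1 := Set.ncard_le_ncard (s := SlopesOf C) (t := ({s, s'} : Set QP1)) hcon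
      (Set.toFinite _)
    have h2 := Set.ncard_pair hne
    omega
  simp only [Set.mem_insert_iff, Set.mem_singleton_iff, not_or] at hx
  rcases incr3_total (Ne.symm hx.1) hx.2 hne with h | h
  · exact theta_core h01 gr hgr C hsub s s' hs hs' c hc h
  · exact theta_core h01 gr hgr C hsub s' s hs' hs c hc h.rot.rot.rot.rot.rot
end

section
/- (Characterization of G-thin filling spaces.) Let C be a non-trivial line set. Then Θ(C) is either empty, a single point, two distinct points, or an interval in QP¹. Moreover, if G = ℤ/2 then the case of two distinct points does not arise. -/
open OnePoint

/-- Slopes as elements of a linear order, with infinity on top. -/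
def toLin (x : QP1) : WithTop ℚ := x

theorem toLin_inj {x y : QP1} : toLin x = toLin y ↔ x = y := Iff.rfl

theorem incr3_iff (x y z : QP1) : Incr3 x y z ↔
    (toLin x < toLin y ∧ toLin y < toLin z) ∨ (toLin y < toLin z ∧ toLin z < toLin x) ∨
      (toLin z < toLin x ∧ toLin x < toLin y) := by
  have hs : ∀ a : ℚ, toLin (Option.some a) = ((a : ℚ) : WithTop ℚ) := fun _ => rfl
  have hn : toLin (Option.none) = (⊤ : WithTop ℚ) := rfl
  rcases x with _ | x <;> rcases y with _ | y <;> rcases z with _ | z <;>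
    simp only [Incr3, hs, hn, WithTop.coe_lt_coe, WithTop.coe_lt_top, not_top_lt, lt_irrefl,
      and_true, and_false, false_and, or_false, false_or]

theorem Incr3.rot_s7 {x y z : QP1} (h : Incr3 x y z) : Incr3 y z x := by
  rw [incr3_iff] at *; tauto

theorem Incr3.ne12 {x y z : QP1} (h : Incr3 x y z) : x ≠ y := by
  rw [incr3_iff] at h
  rw [Ne, ← toLin_inj]
  grind

theorem Incr3.ne23 {x y z : QP1} (h : Incr3 x y z) : y ≠ z := h.rot_s7.ne12

theorem Incr3.ne13 {x y z : QP1} (h : Incr3 x y z) : x ≠ z := h.rot_s7.rot_s7.ne12.symm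

theorem incr3_total_s7 {x y z : QP1} (h : x ≠ y) (h' : y ≠ z) (h'' : x ≠ z) :
    Incr3 x y z ∨ Incr3 x z y := by
  rw [incr3_iff, incr3_iff]
  rw [Ne, ← toLin_inj] at h h' h''
  grind

theorem Incr3.asymm {x y z : QP1} (h : Incr3 x y z) : ¬ Incr3 x z y := by
  rw [incr3_iff] at *
  grind

theorem Incr3.trans {p x y z : QP1} (h : Incr3 p x y) (h' : Incr3 p y z) : Incr3 p x z := by
  rw [incr3_iff] at *
  grind

theorem exists_incr3 {x y : QP1} (h : x ≠ y) : ∃ p, Incr3 x p y := by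
  rcases x with _ | x <;> rcases y with _ | y
  · exact absurd rfl h
  · exact ⟨Option.some (y - 1), by simp [Incr3]⟩
  · exact ⟨Option.some (x + 1), by simp [Incr3]⟩
  · have hxy : x ≠ y := fun e => h (by rw [e])
    rcases lt_or_gt_of_ne hxy with hl | hl
    · obtain ⟨q, h1, h2⟩ := exists_between hl
      exact ⟨Option.some q, Or.inl ⟨h1, h2⟩⟩
    · exact ⟨Option.none, hl⟩

theorem finite_exists_least {α : Type*} (R : α → α → Prop)
    (htr : ∀ x y z, R x y → R y z → R x z) (C : Set α) (hfin : C.Finite) (hne : C.Nonempty)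
    (htot : ∀ x ∈ C, ∀ y ∈ C, R x y ∨ R y x) : ∃ b ∈ C, ∀ d ∈ C, R b d := by
  induction C, hfin using Set.Finite.induction_on with
  | empty => exact absurd hne (by simp)
  | @insert a s _ _ ih =>
    have haa : R a a := by
      rcases htot a (by simp) a (by simp) with h | h <;> exact h
    rcases s.eq_empty_or_nonempty with rfl | hs
    · exact ⟨a, by simp, by simpa using haa⟩
    · obtain ⟨b, hb, hbd⟩ := ih hs (fun x hx y hy => htot x (by simp [hx]) y (by simp [hy]))
      rcases htot a (by simp) b (by simp [hb]) with h | h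
      · refine ⟨a, by simp, ?_⟩
        rintro d (rfl | hd)
        · exact haa
        · exact htr _ _ _ h (hbd d hd)
      · refine ⟨b, by simp [hb], ?_⟩
        rintro d (rfl | hd)
        · exact h
        · exact hbd d hd

section
variable {G : Type*} [CommRing G] {gr : Line G → Line G → G}

theorem mem_theta {C : Set (Line G)} {s : QP1} : s ∈ Theta gr C ↔
    ∃ n : G, ∀ d ∈ C, (s = d.slope → d.eps = true) ∧ (s ≠ d.slope → gr ⟨s, 0, false⟩ d = n) := by
  simp [Theta, ThinPair]

/-- Description of the filling space relative to a filling slope outside the support. -/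
theorem mem_theta_of_base (h1 : (1 : G) ≠ 0) (hgr : IsGradingFunction gr) {C : Set (Line G)}
    {p : QP1} (hp : p ∈ Theta gr C) (hpC : ∀ d ∈ C, p ≠ d.slope) {s : QP1} (hs : s ≠ p) :
    s ∈ Theta gr C ↔ (∀ d ∈ C, s = d.slope → d.eps = true) ∧
      ((∀ d ∈ C, s = d.slope ∨ Incr3 p s d.slope) ∨
        (∀ d ∈ C, s = d.slope ∨ Incr3 p d.slope s)) := by
  obtain ⟨n, hn⟩ := mem_theta.1 hp
  have hA : ∀ d ∈ C, Incr3 p s d.slope →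
      gr ⟨s, 0, false⟩ d = n - gr ⟨p, 0, false⟩ ⟨s, 0, false⟩ := by
    intro d hd hi
    have e1 := hgr.trans ⟨p, 0, false⟩ ⟨s, 0, false⟩ d hi
    have e2 := (hn d hd).2 (hpC d hd)
    linear_combination e1 + e2
  have hB : ∀ d ∈ C, Incr3 p d.slope s →
      gr ⟨s, 0, false⟩ d = n - 1 - gr ⟨p, 0, false⟩ ⟨s, 0, false⟩ := by
    intro d hd hi
    have e1 := hgr.trans ⟨s, 0, false⟩ ⟨p, 0, false⟩ d hi.rot_s7.rot_s7
    have e2 := (hn d hd).2 (hpC d hd)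
    have e3 := hgr.symm_ne ⟨s, 0, false⟩ ⟨p, 0, false⟩ hs
    linear_combination -e1 + e2 + e3
  rw [mem_theta]
  constructor
  · rintro ⟨m, hm⟩
    refine ⟨fun d hd => (hm d hd).1, ?_⟩
    by_contra hcon
    push Not at hcon
    obtain ⟨⟨d, hd, hds, hdi⟩, ⟨d', hd', hds', hdi'⟩⟩ := hcon
    have i1 := (incr3_total_s7 hs.symm hds (hpC d hd)).resolve_left hdi
    have i2 := (incr3_total_s7 hs.symm hds' (hpC d' hd')).resolve_right hdi'
    have e1 := hB d hd i1
    have e2 := hA d' hd' i2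
    rw [(hm d hd).2 hds] at e1
    rw [(hm d' hd').2 hds'] at e2
    exact h1 (by linear_combination e1 - e2)
  · rintro ⟨hsp, h | h⟩
    · exact ⟨_, fun d hd => ⟨hsp d hd, fun hne => hA d hd ((h d hd).resolve_left hne)⟩⟩
    · exact ⟨_, fun d hd => ⟨hsp d hd, fun hne => hB d hd ((h d hd).resolve_left hne)⟩⟩

theorem interval_of_base (h1 : (1 : G) ≠ 0) (hgr : IsGradingFunction gr) {C : Set (Line G)}
    (hCfin : C.Finite) (hCne : C.Nonempty) (hnt : ¬ TrivialLineSet C)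
    {p : QP1} (hp : p ∈ Theta gr C) (hpC : ∀ d ∈ C, p ≠ d.slope) :
    IsInterval (Theta gr C) := by
  have htr : ∀ x y z : QP1, (x = y ∨ Incr3 p x y) → (y = z ∨ Incr3 p y z) →
      (x = z ∨ Incr3 p x z) := by
    rintro x y z (rfl | h) (rfl | h')
    · exact Or.inl rfl
    · exact Or.inr h'
    · exact Or.inr h
    · exact Or.inr (h.trans h')
  have htot : ∀ x ∈ C, ∀ y ∈ C, (x.slope = y.slope ∨ Incr3 p x.slope y.slope) ∨
      (y.slope = x.slope ∨ Incr3 p y.slope x.slope) := by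
    intro x hx y hy
    by_cases hxy : x.slope = y.slope
    · exact Or.inl (Or.inl hxy)
    · rcases incr3_total_s7 (hpC x hx) hxy (hpC y hy) with h | h
      · exact Or.inl (Or.inr h)
      · exact Or.inr (Or.inr h)
  obtain ⟨b, hb, hbd⟩ := finite_exists_least
    (fun x y : Line G => x.slope = y.slope ∨ Incr3 p x.slope y.slope)
    (fun x y z => htr _ _ _) C hCfin hCne htot
  obtain ⟨a, ha, had⟩ := finite_exists_least
    (fun x y : Line G => y.slope = x.slope ∨ Incr3 p y.slope x.slope)
    (fun x y z h h' => htr _ _ _ h' h) C hCfin hCne (fun x hx y hy => htot y hy x hx)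
  -- trivial support is excluded
  have hnosing : ∀ s : QP1, (∀ d ∈ C, s = d.slope) → ¬ (∀ d ∈ C, s = d.slope → d.eps = true) := by
    intro s hall hsp
    refine hnt ⟨s, ?_, fun d hd hds => hsp d hd hds.symm⟩
    ext t
    constructor
    · rintro ⟨d, hd, rfl⟩
      exact (hall d hd).symm
    · rintro rfl
      obtain ⟨d, hd⟩ := hCne
      exact ⟨d, hd, (hall d hd).symm⟩
  -- points before the least slope or after the greatest are filling
  have hout : ∀ s, (s = p ∨ Incr3 p s b.slope ∨ Incr3 p a.slope s) → s ∈ Theta gr C := by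
    rintro s (rfl | h | h)
    · exact hp
    · refine (mem_theta_of_base h1 hgr hp hpC h.ne12.symm).2 ?_
      have hall : ∀ d ∈ C, Incr3 p s d.slope := by
        intro d hd
        rcases hbd d hd with e | e
        · rw [← e]; exact h
        · exact h.trans e
      exact ⟨fun d hd e => absurd e (hall d hd).ne23, Or.inl fun d hd => Or.inr (hall d hd)⟩
    · refine (mem_theta_of_base h1 hgr hp hpC h.ne13.symm).2 ?_
      have hall : ∀ d ∈ C, Incr3 p d.slope s := by
        intro d hd
        rcases had d hd with e | e
        · rw [e]; exact h
        · exact e.trans h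
      exact ⟨fun d hd e => absurd e.symm (hall d hd).ne23, Or.inr fun d hd => Or.inr (hall d hd)⟩
  have hin : ∀ s ∈ Theta gr C, s = p ∨ Incr3 p s b.slope ∨ Incr3 p a.slope s ∨
      (a.slope ≠ b.slope ∧ (s = a.slope ∨ s = b.slope)) := by
    intro s hs
    by_cases hsp : s = p
    · exact Or.inl hsp
    have hsing : a.slope = b.slope → (∀ d ∈ C, a.slope = d.slope) := by
      intro hab d hd
      rcases had d hd with e | e
      · exact e.symm
      · rcases hbd d hd with e' | e'
        · rw [hab, e']
        · rw [hab] at e; exact absurd e e'.asymm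
    obtain ⟨h1, h2⟩ := (mem_theta_of_base h1 hgr hp hpC hsp).1 hs
    have hab' : (s = a.slope ∨ s = b.slope) → a.slope ≠ b.slope := by
      intro h hab
      have : s = a.slope := by
        rcases h with h | h
        · exact h
        · rw [h, hab]
      rw [this] at h1
      exact hnosing _ (hsing hab) h1
    rcases h2 with h2 | h2
    · rcases h2 b hb with e | e
      · exact Or.inr (Or.inr (Or.inr ⟨hab' (Or.inr e), Or.inr e⟩))
      · exact Or.inr (Or.inl e)
    · rcases h2 a ha with e | e
      · exact Or.inr (Or.inr (Or.inr ⟨hab' (Or.inl e), Or.inl e⟩))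
      · exact Or.inr (Or.inr (Or.inl e))
  have hpb := hpC b hb
  have hpa := hpC a ha
  have hI : ∀ s, s ∈ Intvl a.slope b.slope ↔
      (s = p ∨ Incr3 p s b.slope ∨ Incr3 p a.slope s) := by
    intro s
    unfold Intvl
    split_ifs with hab
    · rw [hab]
      constructor
      · intro hs
        by_cases hsp : s = p
        · exact Or.inl hsp
        · exact Or.inr (incr3_total_s7 (Ne.symm hsp) hs hpb)
      · rintro (rfl | h | h)
        · exact hpb
        · exact h.ne23
        · exact h.ne23.symm
    · have hba : Incr3 p b.slope a.slope := (hbd a ha).resolve_left (Ne.symm hab)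
      show Incr3 a.slope s b.slope ↔ _
      clear hout hin hnosing htr htot hbd had
      simp only [incr3_iff] at *
      rw [← toLin_inj (x := s) (y := p)]
      grind
  have hsub : Intvl a.slope b.slope ⊆ Theta gr C := fun s hs => hout s ((hI s).1 hs)
  have hsup : ∀ s ∈ Theta gr C, s ∈ Intvl a.slope b.slope ∨ s = a.slope ∨ s = b.slope := by
    intro s hs
    rcases hin s hs with h | h | h | h
    · exact Or.inl ((hI s).2 (Or.inl h))
    · exact Or.inl ((hI s).2 (Or.inr (Or.inl h)))
    · exact Or.inl ((hI s).2 (Or.inr (Or.inr h)))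
    · exact Or.inr h.2
  refine ⟨?_, a.slope, b.slope, ?_⟩
  · obtain ⟨q, hq⟩ := exists_incr3 hpb
    exact ⟨p, hp, q, hout q (Or.inr (Or.inl hq)), hq.ne12⟩
  · by_cases hat : a.slope ∈ Theta gr C <;> by_cases hbt : b.slope ∈ Theta gr C
    · right; right; right
      ext s
      simp only [Set.mem_insert_iff]
      constructor
      · intro hs
        have := hsup s hs
        tauto
      · rintro (rfl | rfl | h)
        · exact hat
        · exact hbt
        · exact hsub h
    · right; left
      ext s
      simp only [Set.mem_insert_iff]
      constructor
      · intro hs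
        have := hsup s hs
        have : s ≠ b.slope := fun e => hbt (e ▸ hs)
        tauto
      · rintro (rfl | h)
        · exact hat
        · exact hsub h
    · right; right; left
      ext s
      simp only [Set.mem_insert_iff]
      constructor
      · intro hs
        have := hsup s hs
        have : s ≠ a.slope := fun e => hat (e ▸ hs)
        tauto
      · rintro (rfl | h)
        · exact hbt
        · exact hsub h
    · left
      ext s
      constructor
      · intro hs
        have := hsup s hs
        have : s ≠ b.slope := fun e => hbt (e ▸ hs)
        have : s ≠ a.slope := fun e => hat (e ▸ hs)
        tauto
      · exact fun h => hsub h

theorem no_three (h1 : (1 : G) ≠ 0) (hgr : IsGradingFunction gr) {C : Set (Line G)}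
    (hsub : ∀ s ∈ Theta gr C, ∃ d ∈ C, s = d.slope) {x y z : QP1}
    (hx : x ∈ Theta gr C) (hy : y ∈ Theta gr C) (hz : z ∈ Theta gr C) : ¬ Incr3 x y z := by
  intro hi
  obtain ⟨a, ha, rfl⟩ := hsub x hx
  obtain ⟨b, hb, rfl⟩ := hsub y hy
  obtain ⟨c, hc, rfl⟩ := hsub z hz
  have key : ∀ a ∈ C, ∀ b ∈ C, ∀ c ∈ C, a.slope ∈ Theta gr C →
      Incr3 a.slope b.slope c.slope → gr b c = 0 := by
    intro a _ b hb c hc hat hi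
    obtain ⟨n, hn⟩ := mem_theta.1 hat
    have e1 := hgr.trans ⟨a.slope, 0, false⟩ b c hi
    have e2 := (hn b hb).2 hi.ne12
    have e3 := (hn c hc).2 hi.ne13
    linear_combination e1 - e2 + e3
  have k1 := key a ha b hb c hc hx hi
  have k2 := key b hb c hc a ha hy hi.rot_s7
  have k3 := key c hc a ha b hb hz hi.rot_s7.rot_s7
  have k4 := hgr.trans a b c hi
  have k5 := hgr.symm_ne a c hi.ne13
  exact h1 (by linear_combination k5 - k2 - k1 - k3 + k4)

theorem exists_between_theta (h1 : (1 : G) ≠ 0) (hgr : IsGradingFunction gr) {C : Set (Line G)}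
    {x y : QP1} (hxy : x ≠ y) {n m : G}
    (hn : ∀ d ∈ C, (x = d.slope → d.eps = true) ∧ (x ≠ d.slope → gr ⟨x, 0, false⟩ d = n))
    (hm : ∀ d ∈ C, (y = d.slope → d.eps = true) ∧ (y ≠ d.slope → gr ⟨y, 0, false⟩ d = m))
    (he : gr ⟨x, 0, false⟩ ⟨y, 0, false⟩ = n - m) : ∃ p ∈ Theta gr C, p ≠ x ∧ p ≠ y := by
  obtain ⟨p, hp⟩ := exists_incr3 hxy
  have hno : ∀ d ∈ C, ¬ Incr3 x d.slope y := by
    intro d hd hi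
    have e1 := hgr.trans ⟨y, 0, false⟩ ⟨x, 0, false⟩ d hi.rot_s7.rot_s7
    have e2 := (hn d hd).2 hi.ne12
    have e3 := (hm d hd).2 hi.ne23.symm
    have e4 := hgr.symm_ne ⟨x, 0, false⟩ ⟨y, 0, false⟩ hxy
    exact h1 (by linear_combination e4 - e1 + e2 - e3 - he)
  refine ⟨p, mem_theta.2 ⟨n - gr ⟨x, 0, false⟩ ⟨p, 0, false⟩, ?_⟩, hp.ne12.symm, hp.ne23⟩
  intro d hd
  refine ⟨fun e => absurd (e ▸ hp) (hno d hd), fun hpd => ?_⟩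
  by_cases hxd : x = d.slope
  · have e1 := hgr.trans ⟨p, 0, false⟩ ⟨y, 0, false⟩ d (by rw [← hxd]; exact hp.rot_s7)
    have e2 := (hm d hd).2 (by rw [← hxd]; exact hxy.symm)
    have e3 := hgr.trans ⟨x, 0, false⟩ ⟨p, 0, false⟩ ⟨y, 0, false⟩ hp
    linear_combination -e1 + e2 + e3 + he
  · have hi : Incr3 x p d.slope := by
      by_cases hyd : y = d.slope
      · rw [← hyd]; exact hp
      · exact hp.trans ((incr3_total_s7 hxy hyd hxd).resolve_right (hno d hd))
    have e1 := hgr.trans ⟨x, 0, false⟩ ⟨p, 0, false⟩ d hi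
    have e2 := (hn d hd).2 hxd
    linear_combination e1 + e2

end

/-- Characterization of `G`-thin filling spaces: for a non-trivial line
set `C`, `Θ(C)` is empty, a single point, two distinct points, or an interval; and for
`G = ℤ/2` the two-point case does not arise. -/
theorem statement7 (G : Type*) [CommRing G] (hG : GoodG G)
    (gr : Line G → Line G → G) (hgr : IsGradingFunction gr)
    (C : Set (Line G)) (hCfin : C.Finite) (hCne : C.Nonempty)
    (hnt : ¬ TrivialLineSet C) :
    (Theta gr C = ∅ ∨ (∃ s : QP1, Theta gr C = {s}) ∨
      (∃ s s' : QP1, s ≠ s' ∧ Theta gr C = {s, s'}) ∨ IsInterval (Theta gr C)) ∧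
    (Nonempty (G ≃+* ZMod 2) →
      ¬ ∃ s s' : QP1, s ≠ s' ∧ Theta gr C = {s, s'}) := by
  have h1 : (1 : G) ≠ 0 := by
    intro h
    rcases hG with ⟨⟨e⟩⟩ | ⟨⟨e⟩⟩
    · have := congrArg e h
      simp at this
    · have := congrArg e h
      simp at this
  constructor
  · by_cases hsub : ∀ s ∈ Theta gr C, ∃ d ∈ C, s = d.slope
    · rcases (Theta gr C).eq_empty_or_nonempty with h | ⟨s, hs⟩
      · exact Or.inl h
      right
      by_cases h' : ∃ s' ∈ Theta gr C, s ≠ s'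
      · obtain ⟨s', hs', hne⟩ := h'
        right; left
        refine ⟨s, s', hne, ?_⟩
        ext t
        constructor
        · intro ht
          by_contra hcon
          simp only [Set.mem_insert_iff, Set.mem_singleton_iff, not_or] at hcon
          rcases incr3_total_s7 hne (Ne.symm hcon.2) (Ne.symm hcon.1) with h | h
          · exact no_three h1 hgr hsub hs hs' ht h
          · exact no_three h1 hgr hsub hs ht hs' h
        · rintro (rfl | rfl)
          · exact hs
          · exact hs'
      · left
        push Not at h'
        exact ⟨s, Set.eq_singleton_iff_unique_mem.2 ⟨hs, fun t ht => (h' t ht).symm⟩⟩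
    · push Not at hsub
      obtain ⟨p, hp, hpC⟩ := hsub
      exact Or.inr (Or.inr (Or.inr (interval_of_base h1 hgr hCfin hCne hnt hp hpC)))
  · rintro ⟨e⟩ ⟨s, s', hne, hT⟩
    have hs : s ∈ Theta gr C := by rw [hT]; simp
    have hs' : s' ∈ Theta gr C := by rw [hT]; simp
    obtain ⟨n, hn⟩ := mem_theta.1 hs
    obtain ⟨m, hm⟩ := mem_theta.1 hs'
    have h2 : ∀ g : G, g = 0 ∨ g = 1 := by
      intro g
      have hz : ∀ z : ZMod 2, z = 0 ∨ z = 1 := by decide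
      rcases hz (e g) with h | h
      · left; exact e.injective (by simpa using h)
      · right; exact e.injective (by simpa using h)
    have hp : ∃ p ∈ Theta gr C, p ≠ s ∧ p ≠ s' := by
      rcases h2 (gr ⟨s, 0, false⟩ ⟨s', 0, false⟩ - (n - m)) with h | h
      · exact exists_between_theta h1 hgr hne hn hm (by linear_combination h)
      · have h20 : (1 + 1 : G) = 0 := by
          rcases h2 (1 + 1) with h | h
          · exact h
          · exact absurd (by linear_combination h) h1
        have e4 := hgr.symm_ne ⟨s, 0, false⟩ ⟨s', 0, false⟩ hne
        obtain ⟨p, hp, hp1, hp2⟩ := exists_between_theta h1 hgr hne.symm hm hn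
          (by linear_combination e4 - h - h20)
        exact ⟨p, hp, hp2, hp1⟩
    obtain ⟨p, hp, hp1, hp2⟩ := hp
    rw [hT] at hp
    rcases hp with h | h
    · exact hp1 h
    · exact hp2 h
end

section
/- Let G = ℤ and let C = {c, c⋆} be a line set with c rational of slope 0, c⋆ special of slope ∞, and set Δ_c = gr(c, c⋆). Then Θ(C) = [∞,0) if Δ_c = 0, Θ(C) = (0,∞] if Δ_c = −1, and Θ(C) = {∞} otherwise. -/
open OnePoint

theorem aux_mem (gr : Line ℤ → Line ℤ → ℤ) (hgr : IsGradingFunction gr)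
    (c cs : Line ℤ)
    (hc : c.slope = ((0 : ℚ) : QP1)) (hcrat : c.eps = false)
    (hcs : cs.slope = (∞ : QP1)) (hcssp : cs.eps = true) :
    (∞ : QP1) ∈ Theta gr {c, cs} ∧
    ∀ q : ℚ, ((q : QP1) ∈ Theta gr {c, cs} ↔ (q < 0 ∧ gr c cs = 0) ∨ (0 < q ∧ gr c cs = -1)) := by
  refine ⟨⟨gr ⟨∞, 0, false⟩ c, ?_⟩, fun q => ?_⟩
  · rintro _ rfl d (rfl | rfl)
    · simp [hc]
    · simp [hcs, hcssp]
  · have key : (q : QP1) ∈ Theta gr {c, cs} ↔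
        q ≠ 0 ∧ gr ⟨(q : QP1), 0, false⟩ c = gr ⟨(q : QP1), 0, false⟩ cs := by
      constructor
      · rintro ⟨n, hn⟩
        have h1 := hn _ rfl c (Or.inl rfl)
        have h2 := hn _ rfl cs (Or.inr rfl)
        have hq : q ≠ 0 := by
          rintro rfl
          exact h1.1 hc.symm hcrat.symm
        refine ⟨hq, ?_⟩
        rw [h1.2 (by simpa [hc] using hq), h2.2 (by simp [hcs])]
      · rintro ⟨hq, h⟩
        refine ⟨gr ⟨(q : QP1), 0, false⟩ c, ?_⟩
        rintro _ rfl d (rfl | rfl)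
        · simp [hc, hq]
        · simp [hcs, h]
    rw [key]
    rcases lt_trichotomy q 0 with hq | hq | hq
    · have ht := hgr.trans ⟨(q : QP1), 0, false⟩ c cs (by rw [hc, hcs]; exact hq)
      have h1 : q ≠ 0 := hq.ne
      have h2 : ¬ 0 < q := hq.not_gt
      simp only [h1, h2, hq, ne_eq, not_false_eq_true, true_and, false_and, or_false]
      omega
    · simp [hq]
    · have ht := hgr.trans c ⟨(q : QP1), 0, false⟩ cs (by rw [hc, hcs]; exact hq)
      have h1 : q ≠ 0 := hq.ne'
      have h2 : ¬ q < 0 := hq.not_gt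
      have hs := hgr.symm_ne c ⟨(q : QP1), 0, false⟩ (by
        rw [hc]; simpa using h1.symm)
      simp only [h1, h2, hq, ne_eq, not_false_eq_true, true_and, false_and, false_or]
      omega

theorem aux_neg (q : ℚ) : (q : QP1) ∈ Intvl (∞ : QP1) ((0 : ℚ) : QP1) ↔ q < 0 := by
  rw [Intvl, if_neg (OnePoint.infty_ne_coe _)]
  exact Iff.rfl

theorem aux_pos (q : ℚ) : (q : QP1) ∈ Intvl ((0 : ℚ) : QP1) (∞ : QP1) ↔ 0 < q := by
  rw [Intvl, if_neg (OnePoint.coe_ne_infty _)]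
  exact Iff.rfl

/-- For `C = {c, c⋆}` with `c` rational of slope `0` and `c⋆` special of
slope `∞`, and `Δ_c = gr(c, c⋆)`: `Θ(C) = [∞, 0)` if `Δ_c = 0`, `Θ(C) = (0, ∞]` if
`Δ_c = -1`, and `Θ(C) = {∞}` otherwise. -/
theorem statement15 (gr : Line ℤ → Line ℤ → ℤ) (hgr : IsGradingFunction gr)
    (c cs : Line ℤ)
    (hc : c.slope = ((0 : ℚ) : QP1)) (hcrat : c.eps = false)
    (hcs : cs.slope = (∞ : QP1)) (hcssp : cs.eps = true) :
    (gr c cs = 0 →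
      Theta gr {c, cs} = insert (∞ : QP1) (Intvl (∞ : QP1) ((0 : ℚ) : QP1))) ∧
    (gr c cs = -1 →
      Theta gr {c, cs} = insert (∞ : QP1) (Intvl ((0 : ℚ) : QP1) (∞ : QP1))) ∧
    (gr c cs ≠ 0 → gr c cs ≠ -1 → Theta gr {c, cs} = {(∞ : QP1)}) := by
  obtain ⟨hi, hf⟩ := aux_mem gr hgr c cs hc hcrat hcs hcssp
  refine ⟨fun h => ?_, fun h => ?_, fun h h' => ?_⟩
  · ext s
    induction s using OnePoint.rec with
    | infty => simp [hi]
    | coe q => rw [hf, Set.mem_insert_iff, aux_neg]; simp [h]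
  · ext s
    induction s using OnePoint.rec with
    | infty => simp [hi]
    | coe q => rw [hf, Set.mem_insert_iff, aux_pos]; simp [h]
  · ext s
    induction s using OnePoint.rec with
    | infty => simp [hi]
    | coe q => rw [hf]; simp [h, h']
end

section
/- Let G = ℤ, let C = {c, c⋆} and D = {d, d⋆} be line sets where c and d are rational, c⋆ and d⋆ are special, s(c) = 0 = s(d⋆), and s(c⋆) = ∞ = s(d). Set Δ_c = gr(c, c⋆) and Δ_d = gr(d, d⋆). Then the pair (C,D) is thin if and only if Δ_c = Δ_d. -/
open OnePoint

/-- For `C = {c, c⋆}` and `D = {d, d⋆}` with `c, d` rational, `c⋆, d⋆`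
special, `s(c) = 0 = s(d⋆)` and `s(c⋆) = ∞ = s(d)`, the pair `(C, D)` is thin if and
only if `gr(c, c⋆) = gr(d, d⋆)`. -/
theorem statement16 (gr : Line ℤ → Line ℤ → ℤ) (hgr : IsGradingFunction gr)
    (c cs d ds : Line ℤ)
    (hcrat : c.eps = false) (hdrat : d.eps = false)
    (hcssp : cs.eps = true) (hdssp : ds.eps = true)
    (hc : c.slope = ((0 : ℚ) : QP1)) (hds : ds.slope = ((0 : ℚ) : QP1))
    (hcs : cs.slope = (∞ : QP1)) (hd : d.slope = (∞ : QP1)) :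
    ThinPair gr {c, cs} {d, ds} ↔ gr c cs = gr d ds := by
  have key : ∀ a b : Line ℤ, a.slope = ((0 : ℚ) : QP1) → b.slope = (∞ : QP1) →
      gr a ⟨((1 : ℚ) : QP1), 0, false⟩ + gr ⟨((1 : ℚ) : QP1), 0, false⟩ b = gr a b := by
    intro a b ha hb
    apply hgr.trans
    rw [ha, hb]
    exact (zero_lt_one : (0 : ℚ) < 1)
  have h1 := key c cs hc hcs
  have h2 := key c d hc hd
  have h3 := key ds cs hds hcs
  have h4 := key ds d hds hd
  have hne : ((0 : ℚ) : QP1) ≠ ∞ := OnePoint.coe_ne_infty 0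
  have h5 := hgr.symm_ne ds d (by rw [hds, hd]; exact hne)
  have h6 := hgr.symm_ne ds cs (by rw [hds, hcs]; exact hne)
  have hcd : c.slope ≠ d.slope := by rw [hc, hd]; exact hne
  have hsd : cs.slope ≠ ds.slope := by rw [hcs, hds]; exact hne.symm
  constructor
  · rintro ⟨n, hn⟩
    have e1 := (hn c (by simp) d (by simp)).2 hcd
    have e2 := (hn cs (by simp) ds (by simp)).2 hsd
    linarith
  · intro h
    refine ⟨gr c d, ?_⟩
    rintro x (rfl | rfl) y (rfl | rfl)
    · exact ⟨fun e => absurd e hcd, fun _ => rfl⟩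
    · exact ⟨fun _ => by simp [hcrat, hdssp], fun e => absurd (hc.trans hds.symm) e⟩
    · exact ⟨fun _ => by simp [hcssp, hdrat], fun e => absurd (hcs.trans hd.symm) e⟩
    · exact ⟨fun e => absurd e hsd, fun _ => by linarith⟩
end
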